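/- arXiv:math/0303178 — 3 statements merged into one kernel-verified Lean document; each statement's English description precedes it below -/
import Mathlib

section
/- (Modularity of the Dedekind eta function) For σ ∈ ℍ, the function η(σ) = exp(πiσ/12) · ∏_{n=1}^∞ (1 - exp(2πinσ)) satisfies η(-1/σ) = η(σ)·√(-iσ), with the principal branch of the square root. -/
open scoped Real

/-- The Dedekind eta function `η(σ) = exp(πiσ/12) ∏_{n≥1} (1 - exp(2πinσ))`. -/
noncomputable def dedekindEta (σ : ℂ) : ℂ :=
  Complex.exp ((π : ℂ) * Complex.I * σ / 12) *
    ∏' n : ℕ, (1 - Complex.exp (2 * (π : ℂ) * Complex.I * ((n : ℂ) + 1) * σ))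

/-- `dedekindEta` agrees with Mathlib's eta function. -/
theorem dedekindEta_eq_eta (σ : ℂ) : dedekindEta σ = ModularForm.eta σ := by
  simp only [dedekindEta, ModularForm.eta, ModularForm.eta_q_eq_cexp, Function.Periodic.qParam]
  congr 2
  push_cast
  ring

/-- On the upper half plane, `(-iσ) ^ s = i ^ (-s) σ ^ s` for the principal branch. -/
theorem neg_I_mul_cpow_of_im_pos (σ : ℂ) (hσ : 0 < σ.im) (s : ℂ) :
    (-Complex.I * σ) ^ s = (Complex.I ^ s)⁻¹ * σ ^ s := by
  have hσ0 : σ ≠ 0 := by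
    rintro rfl
    simp at hσ
  have hI : -Complex.I ≠ 0 := neg_ne_zero.mpr Complex.I_ne_zero
  have harg : 0 ≤ σ.arg := Complex.arg_nonneg_iff.mpr hσ.le
  have hlog : Complex.log (-Complex.I * σ) = Complex.log (-Complex.I) + Complex.log σ := by
    refine Complex.log_mul hI hσ0 ?_
    rw [Complex.arg_neg_I]
    constructor <;> linarith [Complex.arg_le_pi σ, Real.pi_pos]
  rw [Complex.cpow_def_of_ne_zero (mul_ne_zero hI hσ0), Complex.cpow_def_of_ne_zero hσ0,
    Complex.cpow_def_of_ne_zero Complex.I_ne_zero, hlog, ← Complex.exp_neg, ← Complex.exp_add,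
    Complex.log_neg_I, Complex.log_I]
  congr 1
  ring

/-- Modularity of the Dedekind eta function: `η(-1/σ) = η(σ) √(-iσ)` for `σ ∈ ℍ`,
with the principal branch of the square root. -/
theorem dedekind_eta_modularity (σ : ℂ) (hσ : 0 < σ.im) :
    dedekindEta (-1 / σ) = dedekindEta σ * (-Complex.I * σ) ^ (1 / 2 : ℂ) := by
  have h := ModularForm.eta_comp_eq_csqrt_I_inv hσ
  simp only [Function.comp_apply, Pi.smul_apply, Pi.mul_apply, smul_eq_mul, Complex.sqrt] at h
  rw [dedekindEta_eq_eta, dedekindEta_eq_eta, h, neg_I_mul_cpow_of_im_pos σ hσ, one_div]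
  ring
end

section
/- (Ramanujan 1ψ1 sum in folded form) Let τ ∈ ℍ, q = exp(2πiτ), and 0 < |a|, |b| < 1. Define φ̃(z) = (-a q^{1/2+z}; q)_∞ · (-b q^{1/2-z}; q)_∞ · q^{z²/2}. Then ∑_{m=-∞}^∞ φ̃(z+m) = (1/√(-iτ)) · ((ab;q)_∞ / ((a;q)_∞ (b;q)_∞)) · ϑ_{-1/τ}(z), where ϑ_{-1/τ}(z) = ∑_{m∈ℤ} exp(-πim²/τ) exp(2πimz). -/
open scoped Real

/-- The infinite q-Pochhammer symbol `(a;q)_∞ = ∏_{j=0}^∞ (1 - a q^j)`. -/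
noncomputable def qPochInf (a q : ℂ) : ℂ := ∏' n : ℕ, (1 - a * q ^ n)

open Filter Topology

/-- The coefficients `∏_{i<n} (α - β q^i) / (1 - q^{i+1})` of the power series in `x` of
`(β x; q)_∞ / (α x; q)_∞`. -/
noncomputable def qBinomCoeff (q α β : ℂ) (n : ℕ) : ℂ :=
  ∏ i ∈ Finset.range n, (α - β * q ^ i) / (1 - q ^ (i + 1))

theorem one_sub_pow_succ_ne_zero {q : ℂ} (hq : ‖q‖ < 1) (n : ℕ) : 1 - q ^ (n + 1) ≠ 0 := by
  intro h
  have h1 : ‖q ^ (n + 1)‖ = 1 := by rw [← sub_eq_zero.mp h, norm_one]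
  rw [norm_pow] at h1
  exact (pow_lt_one₀ (norm_nonneg q) hq n.succ_ne_zero).ne h1

theorem qBinomCoeff_zero (q α β : ℂ) : qBinomCoeff q α β 0 = 1 := by simp [qBinomCoeff]

theorem qBinomCoeff_succ (q α β : ℂ) (n : ℕ) :
    qBinomCoeff q α β (n + 1) = qBinomCoeff q α β n * ((α - β * q ^ n) / (1 - q ^ (n + 1))) :=
  Finset.prod_range_succ _ n

theorem summable_norm_qBinomCoeff_mul_pow {q α β x : ℂ} (hq : ‖q‖ < 1) (hx : ‖α * x‖ < 1) :
    Summable fun n ↦ ‖qBinomCoeff q α β n * x ^ n‖ := by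
  obtain ⟨r, hr, hr1⟩ := exists_between hx
  have hpow : Tendsto (fun n ↦ q ^ n) atTop (𝓝 0) := tendsto_pow_atTop_nhds_zero_of_norm_lt_one hq
  have hlim : Tendsto (fun n ↦ ‖(α - β * q ^ n) / (1 - q ^ (n + 1)) * x‖) atTop
      (𝓝 ‖(α - β * 0) / (1 - 0) * x‖) :=
    ((((hpow.const_mul β).const_sub α).div ((hpow.comp (tendsto_add_atTop_nat 1)).const_sub 1)
      (by simp)).mul_const x).norm
  rw [mul_zero, sub_zero, sub_zero, div_one] at hlim
  refine summable_of_ratio_norm_eventually_le hr1 ?_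
  filter_upwards [hlim.eventually_lt_const hr] with n hn
  rw [norm_norm, norm_norm, qBinomCoeff_succ, pow_succ]
  calc _ = ‖(α - β * q ^ n) / (1 - q ^ (n + 1)) * x‖ * ‖qBinomCoeff q α β n * x ^ n‖ := by
        rw [← norm_mul]; ring_nf
    _ ≤ _ := by gcongr

theorem norm_mul_pow_lt_one {q y : ℂ} (hq : ‖q‖ < 1) (hy : ‖y‖ < 1) (n : ℕ) :
    ‖y * q ^ n‖ < 1 := by
  rw [norm_mul, norm_pow]
  exact (mul_le_of_le_one_right (norm_nonneg y) (pow_le_one₀ (norm_nonneg q) hq.le)).trans_lt hy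

theorem tsum_qBinomCoeff_functional_equation {q α β x : ℂ} (hq : ‖q‖ < 1) (hx : ‖α * x‖ < 1) :
    (1 - α * x) * ∑' n, qBinomCoeff q α β n * x ^ n =
      (1 - β * x) * ∑' n, qBinomCoeff q α β n * (x * q) ^ n := by
  have hxq : ‖α * (x * q)‖ < 1 := by
    simpa [mul_assoc] using norm_mul_pow_lt_one hq hx 1
  have h1 := (summable_norm_qBinomCoeff_mul_pow (β := β) hq hx).of_norm
  have h2 := (summable_norm_qBinomCoeff_mul_pow (β := β) hq hxq).of_norm
  have key : ∑' n, qBinomCoeff q α β n * x ^ n - ∑' n, qBinomCoeff q α β n * (x * q) ^ n =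
      α * x * ∑' n, qBinomCoeff q α β n * x ^ n -
        β * x * ∑' n, qBinomCoeff q α β n * (x * q) ^ n := by
    rw [← h1.tsum_sub h2, (h1.sub h2).tsum_eq_zero_add, ← tsum_mul_left, ← tsum_mul_left,
      ← (h1.mul_left _).tsum_sub (h2.mul_left _)]
    simp only [pow_zero, sub_self, zero_add]
    refine tsum_congr fun n ↦ ?_
    have := one_sub_pow_succ_ne_zero hq n
    rw [qBinomCoeff_succ]
    field_simp
    ring
  linear_combination key

theorem multipliable_qPochInf {q : ℂ} (hq : ‖q‖ < 1) (a : ℂ) :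
    Multipliable fun n : ℕ ↦ 1 - a * q ^ n := by
  simp_rw [sub_eq_add_neg]
  refine Complex.multipliable_one_add_of_summable ?_
  exact ((summable_geometric_of_norm_lt_one hq).mul_left a).neg

theorem qPochInf_eq_mul {q : ℂ} (hq : ‖q‖ < 1) (a : ℂ) (n : ℕ) :
    qPochInf a q = (∏ i ∈ Finset.range n, (1 - a * q ^ i)) * qPochInf (a * q ^ n) q := by
  have h := multipliable_qPochInf hq (a * q ^ n)
  simp only [qPochInf]
  rw [← Multipliable.prod_mul_tprod_nat_mul' (k := n)]
  · simp only [pow_add, mul_assoc, mul_comm (q ^ n)]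
  · simpa only [pow_add, mul_assoc, mul_comm (q ^ n)] using h

/-- The `q`-binomial theorem. -/
theorem qPochInf_mul_tsum_qBinomCoeff {q α β x : ℂ} (hq : ‖q‖ < 1) (hx : ‖α * x‖ < 1) :
    qPochInf (α * x) q * ∑' n, qBinomCoeff q α β n * x ^ n = qPochInf (β * x) q := by
  have hpow : Tendsto (fun n ↦ q ^ n) atTop (𝓝 0) := tendsto_pow_atTop_nhds_zero_of_norm_lt_one hq
  have hiter (N : ℕ) : (∏ i ∈ Finset.range N, (1 - α * x * q ^ i)) *
      ∑' n, qBinomCoeff q α β n * x ^ n = (∏ i ∈ Finset.range N, (1 - β * x * q ^ i)) *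
      ∑' n, qBinomCoeff q α β n * (x * q ^ N) ^ n := by
    induction N with
    | zero => simp
    | succ N ih =>
      have h := tsum_qBinomCoeff_functional_equation (β := β) hq (x := x * q ^ N) (α := α)
        (by simpa [mul_assoc] using norm_mul_pow_lt_one hq hx N)
      rw [mul_assoc x, ← pow_succ] at h
      rw [Finset.prod_range_succ, Finset.prod_range_succ]
      linear_combination (1 - α * x * q ^ N) * ih +
        (∏ i ∈ Finset.range N, (1 - β * x * q ^ i)) * h
  have hone : Tendsto (fun N ↦ ∑' n, qBinomCoeff q α β n * (x * q ^ N) ^ n) atTop (𝓝 1) := by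
    rw [← tsum_ite_eq (0 : ℕ) fun _ ↦ (1 : ℂ)]
    refine tendsto_tsum_of_dominated_convergence
      (summable_norm_qBinomCoeff_mul_pow (β := β) hq hx) (fun n ↦ ?_) (.of_forall fun N n ↦ ?_)
    · rcases n with _ | n
      · simp [qBinomCoeff_zero]
      · have h := (((hpow.const_mul x).pow (n + 1)).const_mul (qBinomCoeff q α β (n + 1)))
        simpa using h
    · rw [mul_pow, ← mul_assoc, norm_mul]
      refine mul_le_of_le_one_right (norm_nonneg _) ?_
      rw [norm_pow, norm_pow]
      exact pow_le_one₀ (by positivity) (pow_le_one₀ (norm_nonneg q) hq.le)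
  have hl := (multipliable_qPochInf hq (α * x)).hasProd.tendsto_prod_nat.mul_const
    (∑' n, qBinomCoeff q α β n * x ^ n)
  have hr := (multipliable_qPochInf hq (β * x)).hasProd.tendsto_prod_nat.mul hone
  rw [mul_one] at hr
  exact tendsto_nhds_unique hl (hr.congr fun N ↦ (hiter N).symm)

theorem qPochInf_zero (q : ℂ) : qPochInf 0 q = 1 := by simp [qPochInf]

theorem qPochInf_mul_tsum_qBinomCoeff_one_zero {q x : ℂ} (hq : ‖q‖ < 1) (hx : ‖x‖ < 1) :
    qPochInf x q * ∑' n, qBinomCoeff q 1 0 n * x ^ n = 1 := by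
  simpa [qPochInf_zero] using
    qPochInf_mul_tsum_qBinomCoeff (β := 0) hq (show ‖1 * x‖ < 1 by rwa [one_mul])

theorem qPochInf_ne_zero {q x : ℂ} (hq : ‖q‖ < 1) (hx : ‖x‖ < 1) : qPochInf x q ≠ 0 :=
  left_ne_zero_of_mul_eq_one (qPochInf_mul_tsum_qBinomCoeff_one_zero hq hx)

theorem qBinomCoeff_one (q a : ℂ) (n : ℕ) :
    qBinomCoeff q 1 a n = (∏ i ∈ Finset.range n, (1 - a * q ^ i)) * qBinomCoeff q 1 0 n := by
  rw [qBinomCoeff, qBinomCoeff, ← Finset.prod_mul_distrib]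
  refine Finset.prod_congr rfl fun i _ ↦ ?_
  ring

/-- Evaluating the inner sum with Euler's identity and the outer one with the `q`-binomial
theorem gives `∑_{k,l} a^k b^l q^{kl} / ((q;q)_k (q;q)_l) = (ab;q)_∞ / ((a;q)_∞ (b;q)_∞)`. -/
theorem tsum_tsum_qBinomCoeff {q a b : ℂ} (hq : ‖q‖ < 1) (ha : ‖a‖ < 1) (hb : ‖b‖ < 1) :
    ∑' l, ∑' k, qBinomCoeff q 1 0 k * a ^ k * (qBinomCoeff q 1 0 l * b ^ l) * q ^ (k * l) =
      qPochInf (a * b) q / (qPochInf a q * qPochInf b q) := by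
  have ha' := qPochInf_ne_zero hq ha
  have hb' := qPochInf_ne_zero hq hb
  have hin (l : ℕ) : ∑' k, qBinomCoeff q 1 0 k * a ^ k * (qBinomCoeff q 1 0 l * b ^ l) *
      q ^ (k * l) = qBinomCoeff q 1 a l * b ^ l * (qPochInf a q)⁻¹ := by
    have h := qPochInf_mul_tsum_qBinomCoeff_one_zero hq (norm_mul_pow_lt_one hq ha l)
    have hprod := qPochInf_eq_mul hq a l
    calc _ = qBinomCoeff q 1 0 l * b ^ l * ∑' k, qBinomCoeff q 1 0 k * (a * q ^ l) ^ k := by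
          rw [← tsum_mul_left]
          refine tsum_congr fun k ↦ ?_
          ring
      _ = _ := by
          rw [eq_mul_inv_iff_mul_eq₀ ha', qBinomCoeff_one q a, hprod]
          linear_combination (qBinomCoeff q 1 0 l * b ^ l *
            ∏ i ∈ Finset.range l, (1 - a * q ^ i)) * h
  have hout := qPochInf_mul_tsum_qBinomCoeff (β := a) hq (show ‖1 * b‖ < 1 by rwa [one_mul])
  rw [one_mul] at hout
  simp_rw [hin]
  rw [tsum_mul_right, ← hout]
  field_simp

/-- The Gaussian series `∑ q^{(z+m)²/2}` converges absolutely. -/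
theorem summable_norm_exp_sq {τ : ℂ} (hτ : 0 < τ.im) (z : ℂ) :
    Summable fun m : ℤ ↦ ‖Complex.exp (π * Complex.I * τ * (z + m) ^ 2)‖ := by
  have h := (((summable_jacobiTheta₂_term_iff (z * τ) τ).mpr hτ).mul_left
    (Complex.exp (π * Complex.I * τ * z ^ 2))).norm
  refine h.congr fun m ↦ ?_
  rw [jacobiTheta₂_term, ← Complex.exp_add]
  ring_nf

/-- The modular transformation of the Jacobi theta function as a Poisson summation formula. -/
theorem tsum_exp_sq_eq {τ : ℂ} (hτ : 0 < τ.im) (z : ℂ) :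
    ∑' m : ℤ, Complex.exp (π * Complex.I * τ * (z + m) ^ 2) =
      ((-Complex.I * τ) ^ (1 / 2 : ℂ))⁻¹ * ∑' m : ℤ,
        Complex.exp (-π * Complex.I * m ^ 2 / τ) * Complex.exp (2 * π * Complex.I * m * z) := by
  have hτ0 : τ ≠ 0 := by rintro rfl; simp at hτ
  calc _ = Complex.exp (π * Complex.I * τ * z ^ 2) * jacobiTheta₂ (z * τ) τ := by
        rw [jacobiTheta₂, ← tsum_mul_left]
        refine tsum_congr fun m ↦ ?_
        rw [jacobiTheta₂_term, ← Complex.exp_add]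
        ring_nf
    _ = ((-Complex.I * τ) ^ (1 / 2 : ℂ))⁻¹ * (Complex.exp (π * Complex.I * τ * z ^ 2) *
          Complex.exp (-π * Complex.I * (z * τ) ^ 2 / τ)) * jacobiTheta₂ z (-1 / τ) := by
        rw [jacobiTheta₂_functional_equation, mul_div_cancel_right₀ z hτ0]
        ring
    _ = _ := by
        have h0 : π * Complex.I * τ * z ^ 2 + -π * Complex.I * (z * τ) ^ 2 / τ = 0 := by
          field_simp
          ring
        rw [← Complex.exp_add, h0, Complex.exp_zero, mul_one, jacobiTheta₂]
        congr 1
        refine tsum_congr fun m ↦ ?_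
        rw [jacobiTheta₂_term, ← Complex.exp_add]
        ring_nf

theorem qBinomCoeff_zero_neg_one {τ q : ℂ} (hq : q = Complex.exp (2 * π * Complex.I * τ)) (n : ℕ) :
    qBinomCoeff q 0 (-1) n = Complex.exp (π * Complex.I * τ * (n * (n - 1))) *
      qBinomCoeff q 1 0 n := by
  induction n with
  | zero => simp [qBinomCoeff_zero]
  | succ n ih =>
    have hpow : q ^ n = Complex.exp (n * (2 * π * Complex.I * τ)) := by
      rw [hq, Complex.exp_nat_mul]
    have hexp : Complex.exp (π * Complex.I * τ * ((n + 1 : ℕ) * ((n + 1 : ℕ) - 1))) =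
        Complex.exp (π * Complex.I * τ * (n * (n - 1))) * q ^ n := by
      rw [hpow, ← Complex.exp_add]
      push_cast
      ring_nf
    rw [qBinomCoeff_succ, qBinomCoeff_succ, ih, hexp]
    ring

/-- Euler's expansion of `(-a q^{1/2+w}; q)_∞` in powers of `a`, which converges absolutely. -/
theorem qPochInf_neg_mul_exp {τ q : ℂ} (hq : q = Complex.exp (2 * π * Complex.I * τ))
    (hq1 : ‖q‖ < 1) (a w : ℂ) :
    qPochInf (-a * Complex.exp (2 * π * Complex.I * τ * (1 / 2 + w))) q =
      ∑' n : ℕ, qBinomCoeff q 1 0 n * a ^ n *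
        Complex.exp (π * Complex.I * τ * (n ^ 2 + 2 * n * w)) ∧
    Summable fun n : ℕ ↦ ‖qBinomCoeff q 1 0 n * a ^ n *
        Complex.exp (π * Complex.I * τ * (n ^ 2 + 2 * n * w))‖ := by
  set x := a * Complex.exp (2 * π * Complex.I * τ * (1 / 2 + w)) with hxdef
  have hterm (n : ℕ) : qBinomCoeff q 0 (-1) n * x ^ n = qBinomCoeff q 1 0 n * a ^ n *
      Complex.exp (π * Complex.I * τ * (n ^ 2 + 2 * n * w)) := by
    rw [qBinomCoeff_zero_neg_one hq, hxdef, mul_pow, ← Complex.exp_nat_mul]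
    calc _ = qBinomCoeff q 1 0 n * a ^ n * (Complex.exp (π * Complex.I * τ * (n * (n - 1))) *
          Complex.exp (n * (2 * π * Complex.I * τ * (1 / 2 + w)))) := by ring
      _ = _ := by
          rw [← Complex.exp_add]
          ring_nf
  have hx : ‖0 * x‖ < 1 := by simp
  have h := qPochInf_mul_tsum_qBinomCoeff (β := -1) hq1 hx
  have hs := summable_norm_qBinomCoeff_mul_pow (β := -1) hq1 hx
  simp_rw [hterm] at h hs
  refine ⟨?_, hs⟩
  rw [zero_mul, qPochInf_zero, one_mul] at h
  rw [h, hxdef]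
  ring_nf

/-- Ramanujan's ₁ψ₁ summation in folded form: with
`φ̃(w) = (-a q^{1/2+w};q)_∞ (-b q^{1/2-w};q)_∞ q^{w²/2}` one has
`∑_{m∈ℤ} φ̃(z+m) = (1/√(-iτ)) ((ab;q)_∞/((a;q)_∞(b;q)_∞)) ϑ_{-1/τ}(z)`. -/
theorem ramanujan_one_psi_one_folded (τ a b : ℂ) (hτ : 0 < τ.im)
    (q : ℂ) (hq : q = Complex.exp (2 * (π : ℂ) * Complex.I * τ))
    (ha0 : a ≠ 0) (hb0 : b ≠ 0) (ha : ‖a‖ < 1) (hb : ‖b‖ < 1) (z : ℂ) :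
    (∑' m : ℤ,
      qPochInf (-a * Complex.exp (2 * (π : ℂ) * Complex.I * τ * (1 / 2 + (z + (m : ℂ))))) q *
      qPochInf (-b * Complex.exp (2 * (π : ℂ) * Complex.I * τ * (1 / 2 - (z + (m : ℂ))))) q *
      Complex.exp ((π : ℂ) * Complex.I * τ * (z + (m : ℂ)) ^ 2)) =
    ((-Complex.I * τ) ^ (1 / 2 : ℂ))⁻¹ *
      (qPochInf (a * b) q / (qPochInf a q * qPochInf b q)) *
      ∑' m : ℤ, Complex.exp (-(π : ℂ) * Complex.I * (m : ℂ) ^ 2 / τ)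
        * Complex.exp (2 * (π : ℂ) * Complex.I * (m : ℂ) * z) := by
  have hq1 : ‖q‖ < 1 := by
    rw [hq, Complex.norm_exp, Real.exp_lt_one_iff]
    have hre : (2 * π * Complex.I * τ).re = -(2 * π * τ.im) := by simp
    rw [hre]
    exact neg_neg_of_pos (by positivity)
  have hqpow (n : ℕ) : q ^ n = Complex.exp (n * (2 * π * Complex.I * τ)) := by
    rw [hq, Complex.exp_nat_mul]
  set u : ℕ × ℕ → ℂ := fun p ↦
    qBinomCoeff q 1 0 p.1 * a ^ p.1 * (qBinomCoeff q 1 0 p.2 * b ^ p.2) * q ^ (p.1 * p.2) with hu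
  set g : ℤ → ℂ := fun m ↦ Complex.exp (π * Complex.I * τ * (z + m) ^ 2) with hg
  have hus : Summable fun p ↦ ‖u p‖ := by
    have h := (summable_norm_qBinomCoeff_mul_pow (β := 0) hq1
      (show ‖1 * a‖ < 1 by rwa [one_mul])).mul_norm (summable_norm_qBinomCoeff_mul_pow (β := 0) hq1
      (show ‖1 * b‖ < 1 by rwa [one_mul]))
    refine h.of_nonneg_of_le (fun _ ↦ norm_nonneg _) fun p ↦ ?_
    rw [hu, norm_mul _ (q ^ _), norm_pow]
    exact mul_le_of_le_one_right (norm_nonneg _) (pow_le_one₀ (norm_nonneg q) hq1.le)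
  have hgs : Summable fun m ↦ ‖g m‖ := summable_norm_exp_sq hτ z
  have hshift (p : ℕ × ℕ) : ∑' m : ℤ, g (m + (p.1 - p.2)) = ∑' m, g m :=
    (Equiv.addRight ((p.1 : ℤ) - p.2)).tsum_eq g
  have hterm (m : ℤ) :
      qPochInf (-a * Complex.exp (2 * (π : ℂ) * Complex.I * τ * (1 / 2 + (z + (m : ℂ))))) q *
      qPochInf (-b * Complex.exp (2 * (π : ℂ) * Complex.I * τ * (1 / 2 - (z + (m : ℂ))))) q *
      Complex.exp ((π : ℂ) * Complex.I * τ * (z + (m : ℂ)) ^ 2) =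
      ∑' p, u p * g (m + (p.1 - p.2)) := by
    obtain ⟨hA, hAs⟩ := qPochInf_neg_mul_exp hq hq1 a (z + m)
    obtain ⟨hB, hBs⟩ := qPochInf_neg_mul_exp hq hq1 b (-(z + m))
    rw [sub_eq_add_neg (1 / 2 : ℂ), hA, hB, tsum_mul_tsum_of_summable_norm hAs hBs,
      ← tsum_mul_right]
    refine tsum_congr fun ⟨k, l⟩ ↦ ?_
    have hexp : Complex.exp (π * Complex.I * τ * (k ^ 2 + 2 * k * (z + m))) *
        Complex.exp (π * Complex.I * τ * (l ^ 2 + 2 * l * -(z + m))) *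
        Complex.exp (π * Complex.I * τ * (z + m) ^ 2) = q ^ (k * l) * g (m + (k - l)) := by
      rw [hqpow, hg, ← Complex.exp_add, ← Complex.exp_add, ← Complex.exp_add]
      push_cast
      ring_nf
    linear_combination (qBinomCoeff q 1 0 k * a ^ k * (qBinomCoeff q 1 0 l * b ^ l)) * hexp
  have hsum : Summable (Function.uncurry fun (m : ℤ) (p : ℕ × ℕ) ↦ u p * g (m + (p.1 - p.2))) := by
    let e : ℤ × (ℕ × ℕ) ≃ ℤ × (ℕ × ℕ) :=
      { toFun := fun x ↦ (x.1 + (x.2.1 - x.2.2), x.2)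
        invFun := fun x ↦ (x.1 - (x.2.1 - x.2.2), x.2)
        left_inv := fun x ↦ by simp
        right_inv := fun x ↦ by simp }
    refine (e.summable_iff.mpr (summable_mul_of_summable_norm hgs hus)).congr fun x ↦ ?_
    exact mul_comm _ _
  calc _ = ∑' m : ℤ, ∑' p, u p * g (m + (p.1 - p.2)) := tsum_congr hterm
    _ = ∑' p, ∑' m : ℤ, u p * g (m + (p.1 - p.2)) := hsum.tsum_comm.symm
    _ = (∑' p, u p) * ∑' m, g m := by simp_rw [tsum_mul_left, hshift, tsum_mul_right]
    _ = _ := by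
        have huv : ∑' p, u p = qPochInf (a * b) q / (qPochInf a q * qPochInf b q) := by
          rw [hus.of_norm.tsum_prod, ← tsum_tsum_qBinomCoeff hq1 ha hb]
          exact (Summable.tsum_comm (f := fun k l ↦ u (k, l)) hus.of_norm).symm
        rw [huv, hg, tsum_exp_sq_eq hτ]
        ring
end

section
/- (Special value of the hyperbolic gamma function) For a₊, a₋ ∈ ℂ with Re(a₊), Re(a₋) > 0, the hyperbolic gamma function satisfies Γ_h(a₊,a₋; ia₋/2 - ia₊/2) = √(a₋/a₊), with the principal branch of the square root. -/
open scoped Real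

/-- The integrand of Ruijsenaars' function `g(a₊,a₋;z)`. -/
noncomputable def hypGammaIntegrand (ap am z : ℂ) (y : ℝ) : ℂ :=
  (Complex.sin (2 * (y : ℂ) * z) /
      (2 * Complex.sinh (ap * (y : ℂ)) * Complex.sinh (am * (y : ℂ))) -
    z / (ap * am * (y : ℂ))) / (y : ℂ)

/-- Ruijsenaars' hyperbolic gamma function
`Γ_h(a₊,a₋;z) = exp(i ∫₀^∞ (dy/y)[sin(2yz)/(2sinh(a₊y)sinh(a₋y)) − z/(a₊a₋y)])`. -/
noncomputable def hypGamma (ap am z : ℂ) : ℂ :=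
  Complex.exp (Complex.I * ∫ y in Set.Ioi (0 : ℝ), hypGammaIntegrand ap am z y)

open MeasureTheory Filter Topology

/-- The Langevin function `coth w - 1 / w`, with value `0` at `w = 0`. -/
noncomputable def langevin (w : ℂ) : ℂ := Complex.cosh w / Complex.sinh w - w⁻¹

/-- The derivative `1 / w ^ 2 - 1 / sinh w ^ 2` of the Langevin function. -/
noncomputable def langevinDeriv (w : ℂ) : ℂ := (w ^ 2)⁻¹ - (Complex.sinh w ^ 2)⁻¹

lemma re_le_norm_sinh {w : ℂ} (hw : 0 ≤ w.re) : w.re ≤ ‖Complex.sinh w‖ := by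
  refine (Real.self_le_sinh_iff.2 hw).trans ?_
  have h := norm_sub_norm_le (Complex.exp w) (Complex.exp (-w))
  rw [Complex.norm_exp, Complex.norm_exp, Complex.neg_re] at h
  rw [Real.sinh_eq, Complex.sinh, norm_div, Complex.norm_two]
  linarith

lemma sinh_ne_zero_of_re_pos {w : ℂ} (hw : 0 < w.re) : Complex.sinh w ≠ 0 :=
  norm_pos_iff.1 (hw.trans_le (re_le_norm_sinh hw.le))

lemma hasDerivAt_langevin {w : ℂ} (hw : 0 < w.re) :
    HasDerivAt langevin (langevinDeriv w) w := by
  have hs := sinh_ne_zero_of_re_pos hw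
  have h0 : w ≠ 0 := by
    rintro rfl
    simp at hw
  have h := ((Complex.hasDerivAt_cosh w).div (Complex.hasDerivAt_sinh w) hs).sub
    (hasDerivAt_inv h0)
  refine h.congr_deriv ?_
  have hc := Complex.cosh_sq w
  rw [langevinDeriv]
  field_simp
  linear_combination (-w ^ 2) * hc

lemma norm_sinh_sub_self_le {w : ℂ} (hw : ‖w‖ ≤ 1) :
    ‖Complex.sinh w - w‖ ≤ ‖w‖ ^ 3 := by
  have h1 := Complex.exp_bound hw (n := 3) (by norm_num)
  have h2 := Complex.exp_bound (x := -w) (by simpa using hw) (n := 3) (by norm_num)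
  simp only [Finset.sum_range_succ, Finset.sum_range_zero, norm_neg, Nat.factorial] at h1 h2
  have h3 := norm_sub_le_of_le h1 h2
  have e : Complex.sinh w - w =
      ((Complex.exp w - (0 + w ^ 0 / ((1 : ℕ) : ℂ) + w ^ 1 / (((0 + 1) * 1 : ℕ) : ℂ) +
        w ^ 2 / (((1 + 1) * ((0 + 1) * 1) : ℕ) : ℂ))) -
      (Complex.exp (-w) - (0 + (-w) ^ 0 / ((1 : ℕ) : ℂ) + (-w) ^ 1 / (((0 + 1) * 1 : ℕ) : ℂ) +
        (-w) ^ 2 / (((1 + 1) * ((0 + 1) * 1) : ℕ) : ℂ)))) / 2 := by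
    rw [Complex.sinh]
    push_cast
    ring
  rw [e, norm_div, Complex.norm_two]
  norm_num at h3 ⊢
  nlinarith [pow_nonneg (norm_nonneg w) 3]

lemma norm_cosh_sub_one_le {w : ℂ} (hw : ‖w‖ ≤ 1) :
    ‖Complex.cosh w - 1‖ ≤ ‖w‖ ^ 2 := by
  have h1 := Complex.exp_bound hw (n := 2) (by norm_num)
  have h2 := Complex.exp_bound (x := -w) (by simpa using hw) (n := 2) (by norm_num)
  simp only [Finset.sum_range_succ, Finset.sum_range_zero, norm_neg, Nat.factorial] at h1 h2
  have h3 := norm_add_le_of_le h1 h2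
  have e : Complex.cosh w - 1 =
      ((Complex.exp w - (0 + w ^ 0 / ((1 : ℕ) : ℂ) + w ^ 1 / (((0 + 1) * 1 : ℕ) : ℂ))) +
      (Complex.exp (-w) -
        (0 + (-w) ^ 0 / ((1 : ℕ) : ℂ) + (-w) ^ 1 / (((0 + 1) * 1 : ℕ) : ℂ)))) / 2 := by
    rw [Complex.cosh]
    push_cast
    ring
  rw [e, norm_div, Complex.norm_two]
  norm_num at h3 ⊢
  nlinarith [pow_nonneg (norm_nonneg w) 2]

lemma norm_langevin_le {w : ℂ} (hre : 0 < w.re) (hw : ‖w‖ ≤ 1) :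
    ‖langevin w‖ ≤ 2 * ‖w‖ ^ 2 / w.re := by
  have hs := sinh_ne_zero_of_re_pos hre
  have h0 : w ≠ 0 := by
    rintro rfl
    simp at hre
  have e : langevin w =
      (w * (Complex.cosh w - 1) - (Complex.sinh w - w)) / (w * Complex.sinh w) := by
    rw [langevin]
    field_simp
    ring
  have hn : ‖w * (Complex.cosh w - 1) - (Complex.sinh w - w)‖ ≤ ‖w‖ * (2 * ‖w‖ ^ 2) := by
    refine (norm_sub_le _ _).trans ?_
    rw [norm_mul]
    nlinarith [mul_le_mul_of_nonneg_left (norm_cosh_sub_one_le hw) (norm_nonneg w),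
      norm_sinh_sub_self_le hw]
  have hwp : 0 < ‖w‖ := norm_pos_iff.2 h0
  rw [e, norm_div, norm_mul w (Complex.sinh w)]
  calc _ ≤ ‖w‖ * (2 * ‖w‖ ^ 2) / (‖w‖ * w.re) := by
        gcongr
        exact re_le_norm_sinh hre.le
    _ = _ := by field_simp

lemma norm_langevin_sub_one_le {w : ℂ} (hre : 0 < w.re) : ‖langevin w - 1‖ ≤ 2 / w.re := by
  have hs := sinh_ne_zero_of_re_pos hre
  have e : langevin w - 1 = Complex.exp (-w) / Complex.sinh w - w⁻¹ := by
    rw [langevin, ← Complex.cosh_sub_sinh]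
    field_simp
    ring
  have h1 : ‖Complex.exp (-w) / Complex.sinh w‖ ≤ 1 / w.re := by
    rw [norm_div, Complex.norm_exp]
    gcongr
    · simp [hre.le]
    · exact re_le_norm_sinh hre.le
  have h2 : ‖w⁻¹‖ ≤ 1 / w.re := by
    rw [norm_inv, one_div]
    gcongr
    exact Complex.re_le_norm w
  rw [e]
  calc _ ≤ 1 / w.re + 1 / w.re := norm_sub_le_of_le h1 h2
    _ = _ := by ring

lemma norm_langevinDeriv_le {w : ℂ} (hre : 0 < w.re) :
    ‖langevinDeriv w‖ ≤ 2 / w.re ^ 2 := by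
  have h1 : ‖(Complex.sinh w ^ 2)⁻¹‖ ≤ 1 / w.re ^ 2 := by
    rw [norm_inv, norm_pow, one_div]
    gcongr
    exact re_le_norm_sinh hre.le
  have h2 : ‖(w ^ 2)⁻¹‖ ≤ 1 / w.re ^ 2 := by
    rw [norm_inv, norm_pow, one_div]
    gcongr
    exact Complex.re_le_norm w
  calc _ ≤ 1 / w.re ^ 2 + 1 / w.re ^ 2 := norm_sub_le_of_le h2 h1
    _ = _ := by ring

lemma norm_langevinDeriv_le_of_norm_le_one {w : ℂ} (hre : 0 < w.re) (hw : ‖w‖ ≤ 1) :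
    ‖langevinDeriv w‖ ≤ 3 * ‖w‖ ^ 4 / w.re ^ 4 := by
  have hs := sinh_ne_zero_of_re_pos hre
  have h0 : w ≠ 0 := by
    rintro rfl
    simp at hre
  have e : langevinDeriv w =
      (Complex.sinh w - w) * ((Complex.sinh w - w) + 2 * w) /
        (w ^ 2 * Complex.sinh w ^ 2) := by
    rw [langevinDeriv]
    field_simp
    ring
  have h1 := norm_sinh_sub_self_le hw
  have h2 : ‖(Complex.sinh w - w) + 2 * w‖ ≤ 3 * ‖w‖ := by
    have h3 : ‖w‖ ^ 3 ≤ ‖w‖ := pow_le_of_le_one (norm_nonneg w) hw (by norm_num)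
    refine (norm_add_le _ _).trans ?_
    rw [norm_mul, Complex.norm_two]
    linarith
  rw [e, norm_div, norm_mul, norm_mul (w ^ 2), norm_pow, norm_pow]
  calc _ ≤ ‖w‖ ^ 3 * (3 * ‖w‖) / (w.re ^ 2 * w.re ^ 2) := by
        gcongr
        · exact Complex.re_le_norm w
        · exact re_le_norm_sinh hre.le
    _ = _ := by ring

lemma exists_norm_langevinDeriv_mul_le {r M : ℝ} (hr : 0 < r) (hM : 1 ≤ M) :
    ∃ D : ℝ, ∀ c : ℂ, r ≤ c.re → ‖c‖ ≤ M → ∀ y : ℝ, 0 < y →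
      ‖langevinDeriv (c * y)‖ ≤ D * (1 + y ^ 2)⁻¹ := by
  refine ⟨2 * (M ^ 2 + 1) / r ^ 2 + 6 * M ^ 4 / r ^ 4, fun c hc hcM y hy ↦ ?_⟩
  have hre : (c * y).re = c.re * y := by simp
  have hry : r * y ≤ (c * y).re := by
    rw [hre]
    gcongr
  have hpos : 0 < (c * y).re := (mul_pos hr hy).trans_le hry
  have hnorm : ‖c * y‖ ≤ M * y := by
    rw [norm_mul, Complex.norm_real, Real.norm_of_nonneg hy.le]
    gcongr
  rw [← div_eq_mul_inv, le_div_iff₀ (by positivity)]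
  rcases le_total (M * y) 1 with h | h
  · have hy1 : y ≤ 1 := by nlinarith
    have hb : ‖langevinDeriv (c * y)‖ ≤ 3 * (M * y) ^ 4 / (r * y) ^ 4 :=
      (norm_langevinDeriv_le_of_norm_le_one hpos (hnorm.trans h)).trans (by gcongr)
    calc _ ≤ 3 * (M * y) ^ 4 / (r * y) ^ 4 * 2 := by
          gcongr
          nlinarith
      _ = 6 * M ^ 4 / r ^ 4 := by
          field_simp
          norm_num
      _ ≤ _ := le_add_of_nonneg_left (by positivity)
  · have hb : ‖langevinDeriv (c * y)‖ ≤ 2 / (r * y) ^ 2 :=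
      (norm_langevinDeriv_le hpos).trans (by gcongr)
    calc _ ≤ 2 / (r * y) ^ 2 * ((M ^ 2 + 1) * y ^ 2) := by
          gcongr
          nlinarith
      _ = 2 * (M ^ 2 + 1) / r ^ 2 := by
          field_simp
      _ ≤ _ := le_add_of_nonneg_right (by positivity)

lemma measurable_langevinDeriv : Measurable langevinDeriv := by
  unfold langevinDeriv
  fun_prop

lemma hasDerivAt_langevin_mul {c : ℂ} (hc : 0 < c.re) {y : ℝ} (hy : 0 < y) :
    HasDerivAt (fun y : ℝ ↦ langevin (c * y)) (c * langevinDeriv (c * y)) y := by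
  have hpos : 0 < (c * y).re := by simpa using mul_pos hc hy
  have h1 : HasDerivAt (fun y : ℝ ↦ c * (y : ℂ)) c y := by
    simpa using (Complex.ofRealCLM.hasDerivAt (x := y)).const_mul c
  have := (hasDerivAt_langevin hpos).comp y h1
  rwa [mul_comm] at this

lemma integral_langevinDeriv_mul {c : ℂ} (hc : 0 < c.re) :
    ∫ y in Set.Ioi (0 : ℝ), langevinDeriv (c * y) = c⁻¹ := by
  have hc0 : c ≠ 0 := by
    rintro rfl
    simp at hc
  have hre : ∀ y : ℝ, (c * y).re = c.re * y := by simp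
  have hint : IntegrableOn (fun y : ℝ ↦ c * langevinDeriv (c * y)) (Set.Ioi 0) := by
    obtain ⟨D, hD⟩ := exists_norm_langevinDeriv_mul_le hc (le_max_right ‖c‖ 1)
    refine Integrable.const_mul ?_ c
    refine Integrable.mono' (integrable_inv_one_add_sq.const_mul D).integrableOn
      (measurable_langevinDeriv.comp (by fun_prop)).aestronglyMeasurable ?_
    filter_upwards [ae_restrict_mem measurableSet_Ioi] with y hy
    exact hD c le_rfl (le_max_left _ _) y hy
  have h0 : ContinuousWithinAt (fun y : ℝ ↦ langevin (c * y)) (Set.Ici 0) 0 := by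
    have hL0 : langevin (c * (0 : ℝ)) = 0 := by simp [langevin]
    rw [ContinuousWithinAt, hL0, tendsto_zero_iff_norm_tendsto_zero]
    have hlim : Tendsto (fun y : ℝ ↦ 2 * ‖c‖ ^ 2 / c.re * y) (𝓝[≥] 0) (𝓝 0) := by
      have : Continuous (fun y : ℝ ↦ 2 * ‖c‖ ^ 2 / c.re * y) := by fun_prop
      simpa using (this.tendsto 0).mono_left nhdsWithin_le_nhds
    refine tendsto_of_tendsto_of_tendsto_of_le_of_le' tendsto_const_nhds hlim
      (Eventually.of_forall fun _ ↦ norm_nonneg _) ?_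
    have hsmall : ∀ᶠ y : ℝ in 𝓝[≥] 0, ‖c * y‖ < 1 := by
      have : Continuous (fun y : ℝ ↦ ‖c * y‖) := by fun_prop
      exact nhdsWithin_le_nhds
        ((this.tendsto 0).eventually (Iio_mem_nhds (by simp)))
    filter_upwards [hsmall, self_mem_nhdsWithin] with y hy1 hy
    rcases (Set.mem_Ici.1 hy).eq_or_lt with rfl | hy
    · simp [langevin]
    · refine (norm_langevin_le (by simpa [hre] using mul_pos hc hy) hy1.le).trans_eq ?_
      rw [hre, norm_mul, Complex.norm_real, Real.norm_of_nonneg hy.le]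
      field_simp
  have hinf : Tendsto (fun y : ℝ ↦ langevin (c * y)) atTop (𝓝 1) := by
    rw [tendsto_iff_norm_sub_tendsto_zero]
    have hlim : Tendsto (fun y : ℝ ↦ 2 / (c.re * y)) atTop (𝓝 0) :=
      (tendsto_id.const_mul_atTop hc).const_div_atTop 2
    refine tendsto_of_tendsto_of_tendsto_of_le_of_le' tendsto_const_nhds hlim
      (Eventually.of_forall fun _ ↦ norm_nonneg _) ?_
    filter_upwards [eventually_gt_atTop 0] with y hy
    rw [← hre]
    exact norm_langevin_sub_one_le (by simpa [hre] using mul_pos hc hy)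
  have h := integral_Ioi_of_hasDerivAt_of_tendsto h0
    (fun y hy ↦ hasDerivAt_langevin_mul hc hy) hint hinf
  rw [integral_const_mul] at h
  have hL0 : langevin (c * (0 : ℝ)) = 0 := by simp [langevin]
  rw [hL0, sub_zero] at h
  exact eq_inv_of_mul_eq_one_right h

lemma min_re_le_re_segment (a b : ℂ) {t : ℝ} (h0 : 0 ≤ t) (h1 : t ≤ 1) :
    min a.re b.re ≤ (b + t * (a - b)).re := by
  have e : (b + t * (a - b)).re = (1 - t) * b.re + t * a.re := by
    simp
    ring
  rw [e]
  nlinarith [min_le_left a.re b.re, min_le_right a.re b.re]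

lemma norm_segment_le (a b : ℂ) {t : ℝ} (h0 : 0 ≤ t) (h1 : t ≤ 1) :
    ‖b + t * (a - b)‖ ≤ ‖a‖ + ‖b‖ + 1 := by
  have e : b + t * (a - b) = ((1 - t : ℝ) : ℂ) * b + t * a := by
    push_cast
    ring
  rw [e]
  refine (norm_add_le _ _).trans ?_
  rw [norm_mul, norm_mul, Complex.norm_real, Complex.norm_real, Real.norm_of_nonneg h0,
    Real.norm_of_nonneg (sub_nonneg.2 h1)]
  nlinarith [norm_nonneg a, norm_nonneg b]

lemma hasDerivAt_segment (a b : ℂ) (t : ℝ) :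
    HasDerivAt (fun t : ℝ ↦ b + t * (a - b)) (a - b) t := by
  simpa using ((Complex.ofRealCLM.hasDerivAt (x := t)).mul_const (a - b)).const_add b

/-- Frullani's integral for the Langevin function with complex scales. -/
lemma integral_langevin_sub_div {a b : ℂ} (ha : 0 < a.re) (hb : 0 < b.re) :
    ∫ y in Set.Ioi (0 : ℝ), (langevin (a * y) - langevin (b * y)) / y =
      Complex.log a - Complex.log b := by
  have hr : 0 < min a.re b.re := lt_min ha hb
  have hseg : ∀ t ∈ Set.uIcc (0 : ℝ) 1, 0 < (b + t * (a - b)).re := by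
    intro t ht
    rw [Set.uIcc_of_le zero_le_one] at ht
    exact hr.trans_le (min_re_le_re_segment a b ht.1 ht.2)
  obtain ⟨D, hD⟩ := exists_norm_langevinDeriv_mul_le hr
    (show 1 ≤ ‖a‖ + ‖b‖ + 1 by linarith [norm_nonneg a, norm_nonneg b])
  have hmeas : ∀ y : ℝ, Measurable fun t : ℝ ↦
      (a - b) * langevinDeriv ((b + t * (a - b)) * y) := fun y ↦
    (measurable_langevinDeriv.comp (by fun_prop)).const_mul _
  have hinner : ∀ y ∈ Set.Ioi (0 : ℝ), (langevin (a * y) - langevin (b * y)) / y =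
      ∫ t in (0 : ℝ)..1, (a - b) * langevinDeriv ((b + t * (a - b)) * y) := by
    intro y hy
    have hy0 : (y : ℂ) ≠ 0 := by exact_mod_cast (Set.mem_Ioi.1 hy).ne'
    have hderiv : ∀ t ∈ Set.uIcc (0 : ℝ) 1,
        HasDerivAt (fun t : ℝ ↦ langevin ((b + t * (a - b)) * y) / y)
          ((a - b) * langevinDeriv ((b + t * (a - b)) * y)) t := by
      intro t ht
      have hpos : 0 < ((b + t * (a - b)) * y).re := by
        rw [Complex.re_mul_ofReal]
        exact mul_pos (hseg t ht) hy
      have h := ((hasDerivAt_langevin hpos).comp t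
        ((hasDerivAt_segment a b t).mul_const (y : ℂ))).div_const (y : ℂ)
      refine h.congr_deriv ?_
      field_simp
    have hint : IntervalIntegrable
        (fun t : ℝ ↦ (a - b) * langevinDeriv ((b + t * (a - b)) * y)) volume 0 1 := by
      rw [intervalIntegrable_iff, Set.uIoc_of_le zero_le_one]
      refine Integrable.mono' (integrable_const (‖a - b‖ * (D * (1 + y ^ 2)⁻¹)))
        (hmeas y).aestronglyMeasurable ?_
      filter_upwards [ae_restrict_mem measurableSet_Ioc] with t ht
      rw [norm_mul]
      gcongr
      exact hD _ (min_re_le_re_segment a b ht.1.le ht.2) (norm_segment_le a b ht.1.le ht.2) y hy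
    rw [intervalIntegral.integral_eq_sub_of_hasDerivAt hderiv hint]
    simp [sub_div]
  have hprod : Integrable (Function.uncurry fun t y : ℝ ↦
      (a - b) * langevinDeriv ((b + t * (a - b)) * y))
      ((volume.restrict (Set.uIoc 0 1)).prod (volume.restrict (Set.Ioi 0))) := by
    rw [Set.uIoc_of_le zero_le_one]
    refine Integrable.mono' ((integrable_const (‖a - b‖ * D)).mul_prod
      integrable_inv_one_add_sq.integrableOn)
      ((measurable_langevinDeriv.comp (by fun_prop)).const_mul _).aestronglyMeasurable ?_
    rw [Measure.prod_restrict]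
    filter_upwards [ae_restrict_mem (measurableSet_Ioc.prod measurableSet_Ioi)] with p hp
    obtain ⟨ht, hy⟩ := hp
    simp only [Function.uncurry]
    rw [norm_mul, mul_assoc]
    gcongr
    exact hD _ (min_re_le_re_segment a b ht.1.le ht.2) (norm_segment_le a b ht.1.le ht.2) _ hy
  rw [setIntegral_congr_fun measurableSet_Ioi hinner, ← intervalIntegral_integral_swap hprod]
  have houter : ∀ t ∈ Set.uIcc (0 : ℝ) 1,
      ∫ y in Set.Ioi (0 : ℝ), (a - b) * langevinDeriv ((b + t * (a - b)) * y) =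
        (a - b) / (b + t * (a - b)) := by
    intro t ht
    rw [integral_const_mul, integral_langevinDeriv_mul (hseg t ht), div_eq_mul_inv]
  rw [intervalIntegral.integral_congr houter,
    intervalIntegral.integral_eq_sub_of_hasDerivAt
      (f := fun t : ℝ ↦ Complex.log (b + t * (a - b)))
      (fun t ht ↦ (hasDerivAt_segment a b t).clog_real (Or.inl (hseg t ht)))]
  · simp
  · refine ContinuousOn.intervalIntegrable fun t ht ↦ ?_
    refine ContinuousAt.continuousWithinAt ?_
    refine continuousAt_const.div (hasDerivAt_segment a b t).continuousAt ?_
    intro h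
    simpa [h] using hseg t ht

lemma hypGammaIntegrand_eq_langevin {a b : ℂ} (ha : 0 < a.re) (hb : 0 < b.re) {y : ℝ}
    (hy : 0 < y) :
    hypGammaIntegrand a b (Complex.I * b / 2 - Complex.I * a / 2) y =
      Complex.I / 2 * ((langevin (a * y) - langevin (b * y)) / y) := by
  have hsa : Complex.sinh (a * y) ≠ 0 :=
    sinh_ne_zero_of_re_pos (by simpa using mul_pos ha hy)
  have hsb : Complex.sinh (b * y) ≠ 0 :=
    sinh_ne_zero_of_re_pos (by simpa using mul_pos hb hy)
  have hy0 : (y : ℂ) ≠ 0 := by exact_mod_cast hy.ne'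
  have ha0 : a ≠ 0 := by
    rintro rfl
    simp at ha
  have hb0 : b ≠ 0 := by
    rintro rfl
    simp at hb
  have e : Complex.sin (2 * y * (Complex.I * b / 2 - Complex.I * a / 2)) =
      (Complex.sinh (b * y) * Complex.cosh (a * y) -
        Complex.cosh (b * y) * Complex.sinh (a * y)) * Complex.I := by
    rw [← Complex.sinh_sub, ← Complex.sin_mul_I]
    ring_nf
  rw [hypGammaIntegrand, e, langevin, langevin]
  generalize Complex.sinh (a * y) = s at *
  generalize Complex.sinh (b * y) = s' at *
  field_simp
  ring

lemma log_div_of_re_pos {a b : ℂ} (ha : 0 < a.re) (hb : 0 < b.re) :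
    Complex.log (b / a) = Complex.log b - Complex.log a := by
  have ha0 : a ≠ 0 := by
    rintro rfl
    simp at ha
  have hb0 : b ≠ 0 := by
    rintro rfl
    simp at hb
  have h1 := abs_lt.1 (Complex.abs_arg_lt_pi_div_two_iff.2 (Or.inl ha))
  have h2 := abs_lt.1 (Complex.abs_arg_lt_pi_div_two_iff.2 (Or.inl hb))
  have e : b / a = Complex.exp (Complex.log b - Complex.log a) := by
    rw [Complex.exp_sub, Complex.exp_log ha0, Complex.exp_log hb0]
  rw [e, Complex.log_exp] <;> rw [Complex.sub_im, Complex.log_im, Complex.log_im] <;> linarith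

/-- Special value of the hyperbolic gamma function:
`Γ_h(a₊,a₋; ia₋/2 − ia₊/2) = √(a₋/a₊)` (principal branch). -/
theorem hypGamma_special_value (ap am : ℂ) (hp : 0 < ap.re) (hm : 0 < am.re) :
    hypGamma ap am (Complex.I * am / 2 - Complex.I * ap / 2) =
      (am / ap) ^ (1 / 2 : ℂ) := by
  have ha0 : ap ≠ 0 := by
    rintro rfl
    simp at hp
  have hb0 : am ≠ 0 := by
    rintro rfl
    simp at hm
  rw [hypGamma, setIntegral_congr_fun measurableSet_Ioi
    (fun y hy ↦ hypGammaIntegrand_eq_langevin hp hm hy), integral_const_mul,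
    integral_langevin_sub_div hp hm, Complex.cpow_def_of_ne_zero (div_ne_zero hb0 ha0),
    log_div_of_re_pos hp hm]
  congr 1
  linear_combination (Complex.log ap - Complex.log am) / 2 * Complex.I_mul_I
end
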